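/- (Pieri rule, homogeneous case) For every partition λ, every n ≥ 0, and every number of variables N ≥ 1, s_λ · h_n = Σ_ν s_ν in ℤ[x_1,…,x_N], where the sum is over all partitions ν obtained from λ by adding n boxes with no two added boxes in the same column (i.e. λ ⊆ ν, |ν| = |λ| + n, and ν'_i − λ'_i ≤ 1 for every column index i). -/

import Mathlib

namespace PlethysmSquare

open MvPolynomial Finset

attribute [local instance] Classical.propDecidable

/-- A partition (or any shape) is encoded by its row-length function `ν : ℕ → ℕ`
(`ν i` = length of row `i`, rows indexed from `0`); the cell `(i, j)` belongs to
the Young diagram of `ν` iff `j < ν i`.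

`IsSSYT ν T` says that the filling `T` (entry of cell `(i,j)` is `T i j`; the
entry `k : ℕ` stands for the letter `k + 1`) is a semistandard Young tableau of
shape `ν`: rows weakly increase left to right, columns strictly increase top to
bottom, and all entries outside the diagram are `0`. -/
def IsSSYT (ν : ℕ → ℕ) (T : ℕ → ℕ → ℕ) : Prop :=
  (∀ i j1 j2, j1 ≤ j2 → j2 < ν i → T i j1 ≤ T i j2) ∧
  (∀ i1 i2 j, i1 < i2 → j < ν i1 → j < ν i2 → T i1 j < T i2 j) ∧
  (∀ i j, ν i ≤ j → T i j = 0)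

/-- The number of entries of the filling `T` of the diagram of `ν` equal to `k`. -/
noncomputable def contentCount (ν : ℕ → ℕ) (T : ℕ → ℕ → ℕ) (k : ℕ) : ℕ :=
  Set.ncard {p : ℕ × ℕ | p.2 < ν p.1 ∧ T p.1 p.2 = k}

/-- The Schur polynomial `s_ν` in the `N` variables `x_0, …, x_{N-1}`: the sum,
over all semistandard Young tableaux `T` of shape `ν` with entries in
`{0, …, N-1}`, of the monomial `x^T = ∏_k x_k ^ (number of entries of T equal to k)`.
If `ν` has more than `N` (nonempty) rows there is no such tableau and `s_ν = 0`. -/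
noncomputable def schurPoly (R : Type) [CommRing R] (N : ℕ) (ν : ℕ → ℕ) :
    MvPolynomial (Fin N) R :=
  ∑ᶠ T : ℕ → ℕ → ℕ,
    if IsSSYT ν T ∧ (∀ i j, j < ν i → T i j < N)
    then ∏ k : Fin N, (X k : MvPolynomial (Fin N) R) ^ contentCount ν T (k : ℕ)
    else 0

/-- The Kostka number `K^ν_α`: the number of semistandard Young tableaux of
shape `ν` and content `α` (entries arbitrary, i.e. in all of `ℕ`). -/
noncomputable def kostka (ν : ℕ → ℕ) (α : ℕ → ℕ) : ℕ :=
  Nat.card {T : ℕ → ℕ → ℕ // IsSSYT ν T ∧ ∀ k, contentCount ν T k = α k}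

/-- The conjugate (transposed) partition: `conjPart ν j` is the length of the
`j`-th column of the diagram of `ν`. -/
noncomputable def conjPart (ν : ℕ → ℕ) : ℕ → ℕ := fun j => Set.ncard {i | j < ν i}

/-- `ν` is a partition of `m`: weakly decreasing, finitely many nonzero parts,
and the parts sum to `m`. -/
def IsPartitionOf (m : ℕ) (ν : ℕ → ℕ) : Prop :=
  Antitone ν ∧ (∃ M, ∀ i, M ≤ i → ν i = 0) ∧ (∑ᶠ i, ν i) = m

/-- The cell `(i, j)` lies in the skew diagram `ν / μ`. -/
def InSkew (ν μ : ℕ → ℕ) (p : ℕ × ℕ) : Prop := μ p.1 ≤ p.2 ∧ p.2 < ν p.1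

/-- Semistandard skew tableau of shape `ν / μ`: rows weakly increase, columns
strictly increase, entries outside the skew shape are `0`. -/
def IsSkewSSYT (ν μ : ℕ → ℕ) (T : ℕ → ℕ → ℕ) : Prop :=
  (∀ i j1 j2, j1 ≤ j2 → InSkew ν μ (i, j1) → InSkew ν μ (i, j2) → T i j1 ≤ T i j2) ∧
  (∀ i1 i2 j, i1 < i2 → InSkew ν μ (i1, j) → InSkew ν μ (i2, j) → T i1 j < T i2 j) ∧
  (∀ i j, ¬ InSkew ν μ (i, j) → T i j = 0)

/-- The number of entries equal to `k` of a filling of the skew shape `ν / μ`. -/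
noncomputable def skewContentCount (ν μ : ℕ → ℕ) (T : ℕ → ℕ → ℕ) (k : ℕ) : ℕ :=
  Set.ncard {p : ℕ × ℕ | InSkew ν μ p ∧ T p.1 p.2 = k}

/-- The skew Kostka number `K^{ν/μ}_α`: the number of semistandard skew
tableaux of shape `ν / μ` and content `α`. -/
noncomputable def skewKostka (ν μ : ℕ → ℕ) (α : ℕ → ℕ) : ℕ :=
  Nat.card {T : ℕ → ℕ → ℕ // IsSkewSSYT ν μ T ∧ ∀ k, skewContentCount ν μ T k = α k}

/-- A `λ`-tuple of row tableaux: `t i` (given by `j ↦ t i j`, `j < lam i`) is a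
weakly increasing sequence of length `lam i`; entries outside are `0`. -/
def IsRowTuple (lam : ℕ → ℕ) (t : ℕ → ℕ → ℕ) : Prop :=
  (∀ i j1 j2, j1 ≤ j2 → j2 < lam i → t i j1 ≤ t i j2) ∧ (∀ i j, lam i ≤ j → t i j = 0)

/-- A `λ`-tuple of column tableaux: `t i` is a strictly increasing sequence of
length `lam i`; entries outside are `0`. -/
def IsColTuple (lam : ℕ → ℕ) (t : ℕ → ℕ → ℕ) : Prop :=
  (∀ i j1 j2, j1 < j2 → j2 < lam i → t i j1 < t i j2) ∧ (∀ i j, lam i ≤ j → t i j = 0)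

/-- The ring endomorphism `φ` of `R[x_0, …, x_{N-1}]` determined by `x_i ↦ x_i ^ 2`
(so that `φ g` is the plethysm `p_2[g]`). -/
noncomputable def squareVars (R : Type) [CommRing R] (N : ℕ) :
    MvPolynomial (Fin N) R →+* MvPolynomial (Fin N) R :=
  (MvPolynomial.aeval fun i : Fin N => (X i : MvPolynomial (Fin N) R) ^ 2).toRingHom

/-- The symmetric part `s_2[g] = (g² + φ(g))/2` of the square of `g`. -/
noncomputable def s2pleth (N : ℕ) (g : MvPolynomial (Fin N) ℚ) : MvPolynomial (Fin N) ℚ :=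
  ((1 : ℚ) / 2) • (g ^ 2 + squareVars ℚ N g)

/-- The anti-symmetric part `s_{11}[g] = (g² − φ(g))/2` of the square of `g`. -/
noncomputable def s11pleth (N : ℕ) (g : MvPolynomial (Fin N) ℚ) : MvPolynomial (Fin N) ℚ :=
  ((1 : ℚ) / 2) • (g ^ 2 - squareVars ℚ N g)

/-- The two-row shape `(a, b)` (for `b ≤ a`). -/
def twoRow (a b : ℕ) : ℕ → ℕ := fun i => if i = 0 then a else if i = 1 then b else 0

/-- The shape `(2^a, 1^b)`: `a` rows of length `2` followed by `b` rows of length `1`. -/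
def twoOneShape (a b : ℕ) : ℕ → ℕ := fun i => if i < a then 2 else if i < a + b then 1 else 0

/-- `ν / μ` is a horizontal strip: the rows of `μ` and `ν` interlace. -/
def IsHorizontalStrip (μ ν : ℕ → ℕ) : Prop := ∀ i, μ i ≤ ν i ∧ ν (i + 1) ≤ μ i

theorem IsHorizontalStrip.antitone_left {μ ν : ℕ → ℕ} (h : IsHorizontalStrip μ ν) : Antitone μ :=
  antitone_nat_of_succ_le fun i => (h (i + 1)).1.trans (h i).2

theorem IsHorizontalStrip.antitone_right {μ ν : ℕ → ℕ} (h : IsHorizontalStrip μ ν) : Antitone ν :=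
  antitone_nat_of_succ_le fun i => (h i).2.trans (h i).1

theorem degree_eq_sum_range (ν : ℕ →₀ ℕ) {M : ℕ} (h : ∀ i, M ≤ i → ν i = 0) :
    ν.degree = ∑ i ∈ range M, ν i := by
  rw [Finsupp.degree_apply]
  refine Finset.sum_subset (fun i hi => ?_) fun i _ hi => by simpa using hi
  by_contra hM
  exact (Finsupp.mem_support_iff.1 hi) (h i (by simpa using hM))

theorem exists_forall_ge_eq_zero (ν : ℕ →₀ ℕ) : ∃ M, ∀ i, M ≤ i → ν i = 0 := by
  refine ⟨ν.support.sup id + 1, fun i hi => ?_⟩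
  by_contra h
  have := Finset.le_sup (f := id) (Finsupp.mem_support_iff.2 h)
  simp only [id] at this
  omega

/-- A finitely supported function built from an eventually vanishing sequence. -/
noncomputable def ofEventuallyZero (f : ℕ → ℕ) (h : ∃ M, ∀ i, M ≤ i → f i = 0) : ℕ →₀ ℕ :=
  Finsupp.ofSupportFinite f <| by
    obtain ⟨M, hM⟩ := h
    refine (Set.finite_Iio M).subset fun i hi => ?_
    by_contra hlt
    exact hi (hM i (by simpa using hlt))

theorem finsum_eq_degree (ν : ℕ →₀ ℕ) : ∑ᶠ i, ν i = ν.degree := by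
  rw [Finsupp.degree_apply]
  exact finsum_eq_sum_of_support_subset _ fun i hi => by simpa using hi

/-- The partitions obtained from `ν` by removing a horizontal strip. -/
noncomputable def stripsBelow (ν : ℕ →₀ ℕ) : Finset (ℕ →₀ ℕ) :=
  (Finset.Iic ν).filter fun μ => IsHorizontalStrip μ ν

theorem mem_stripsBelow {μ ν : ℕ →₀ ℕ} : μ ∈ stripsBelow ν ↔ IsHorizontalStrip μ ν := by
  simp only [stripsBelow, Finset.mem_filter, Finset.mem_Iic, and_iff_right_iff_imp]
  exact fun h i => (h i).1

/-- The partitions obtained from `lam` by adding a horizontal strip of size `n`. -/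
noncomputable def stripsAbove (lam : ℕ →₀ ℕ) (n : ℕ) : Finset (ℕ →₀ ℕ) :=
  (Finset.finsuppAntidiag (range (lam.support.sup id + 2)) (lam.degree + n)).filter
    fun ν => IsHorizontalStrip lam ν

theorem mem_stripsAbove {lam ν : ℕ →₀ ℕ} {n : ℕ} :
    ν ∈ stripsAbove lam n ↔ IsHorizontalStrip lam ν ∧ ν.degree = lam.degree + n := by
  simp only [stripsAbove, Finset.mem_filter, Finset.mem_finsuppAntidiag]
  have key (h : IsHorizontalStrip lam ν) : ∀ i, lam.support.sup id + 2 ≤ i → ν i = 0 := by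
    intro i hi
    obtain ⟨k, rfl⟩ : ∃ k, i = k + 1 := ⟨i - 1, by omega⟩
    by_contra h0
    have hk : lam k ≠ 0 := fun h1 => h0 (Nat.le_zero.1 (h1 ▸ (h k).2))
    have := Finset.le_sup (f := id) (Finsupp.mem_support_iff.2 hk)
    simp only [id] at this
    omega
  constructor
  · rintro ⟨⟨h1, -⟩, h⟩
    exact ⟨h, by rw [degree_eq_sum_range ν (key h), ← h1]⟩
  · rintro ⟨h, h1⟩
    refine ⟨⟨by rw [← h1, degree_eq_sum_range ν (key h)], fun i hi => ?_⟩, h⟩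
    by_contra hlt
    exact Finsupp.mem_support_iff.1 hi (key h i (by simpa using hlt))

/-! ### Local toggles -/

theorem exists_forall_ge_toggle_eq_zero (lam ρ f : ℕ →₀ ℕ) (s : ℕ) :
    ∃ M, ∀ i, M ≤ i →
      min (lam i) (ρ i) + max (lam (i + 1)) (ρ (i + 1)) - f (i + s) = 0 := by
  obtain ⟨A, hA⟩ := exists_forall_ge_eq_zero lam
  obtain ⟨B, hB⟩ := exists_forall_ge_eq_zero ρ
  refine ⟨A + B, fun i hi => ?_⟩
  rw [hA i (by omega), hA (i + 1) (by omega), hB (i + 1) (by omega)]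
  simp

/-- Reflect each part of `ν` but the first in the interval allowed by `lam` and `ρ`,
and forget the first part. -/
noncomputable def toggleDown (lam ρ ν : ℕ →₀ ℕ) : ℕ →₀ ℕ :=
  ofEventuallyZero
    (fun i => min (lam i) (ρ i) + max (lam (i + 1)) (ρ (i + 1)) - ν (i + 1))
    (exists_forall_ge_toggle_eq_zero lam ρ ν 1)

/-- Reflect each part of `μ` in the interval allowed by `lam` and `ρ`, and prepend a first part
exceeding those of `lam` and `ρ` by `k`. -/
noncomputable def toggleUp (lam ρ μ : ℕ →₀ ℕ) (k : ℕ) : ℕ →₀ ℕ :=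
  ofEventuallyZero
    (fun i => Nat.casesOn i (max (lam 0) (ρ 0) + k) fun i =>
      min (lam i) (ρ i) + max (lam (i + 1)) (ρ (i + 1)) - μ i) <| by
    obtain ⟨M, hM⟩ := exists_forall_ge_toggle_eq_zero lam ρ μ 0
    refine ⟨M + 1, fun i hi => ?_⟩
    obtain ⟨j, rfl⟩ : ∃ j, i = j + 1 := ⟨i - 1, by omega⟩
    exact hM j (by omega)

theorem toggleDown_apply (lam ρ ν : ℕ →₀ ℕ) (i : ℕ) : toggleDown lam ρ ν i =
    min (lam i) (ρ i) + max (lam (i + 1)) (ρ (i + 1)) - ν (i + 1) := rfl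

theorem toggleUp_zero (lam ρ μ : ℕ →₀ ℕ) (k : ℕ) :
    toggleUp lam ρ μ k 0 = max (lam 0) (ρ 0) + k := rfl

theorem toggleUp_succ (lam ρ μ : ℕ →₀ ℕ) (k i : ℕ) : toggleUp lam ρ μ k (i + 1) =
    min (lam i) (ρ i) + max (lam (i + 1)) (ρ (i + 1)) - μ i := rfl

section Toggle

variable {lam ρ μ ν : ℕ →₀ ℕ}

theorem isHorizontalStrip_toggleUp (h1 : IsHorizontalStrip μ lam) (h2 : IsHorizontalStrip μ ρ)
    (k : ℕ) : IsHorizontalStrip lam (toggleUp lam ρ μ k) := by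
  intro i
  have a1 := h1 i
  have a2 := h2 i
  rw [toggleUp_succ]
  cases i with
  | zero => rw [toggleUp_zero]; omega
  | succ i =>
    have b1 := h1 i
    have b2 := h2 i
    rw [toggleUp_succ]; omega

theorem isHorizontalStrip_toggleDown (h1 : IsHorizontalStrip lam ν) (h2 : IsHorizontalStrip ρ ν) :
    IsHorizontalStrip (toggleDown lam ρ ν) lam := by
  intro i
  have a1 := h1 i
  have a2 := h2 i
  have b1 := h1 (i + 1)
  have b2 := h2 (i + 1)
  rw [toggleDown_apply]; omega

theorem toggleUp_comm (lam ρ μ : ℕ →₀ ℕ) (k : ℕ) : toggleUp lam ρ μ k = toggleUp ρ lam μ k := by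
  ext i
  cases i with
  | zero => rw [toggleUp_zero, toggleUp_zero, max_comm]
  | succ i => rw [toggleUp_succ, toggleUp_succ, max_comm, min_comm]

theorem toggleDown_comm (lam ρ ν : ℕ →₀ ℕ) : toggleDown lam ρ ν = toggleDown ρ lam ν := by
  ext i
  rw [toggleDown_apply, toggleDown_apply, max_comm, min_comm]

theorem toggleDown_toggleUp (h1 : IsHorizontalStrip μ lam) (h2 : IsHorizontalStrip μ ρ) (k : ℕ) :
    toggleDown lam ρ (toggleUp lam ρ μ k) = μ := by
  ext i
  have a1 := h1 i
  have a2 := h2 i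
  rw [toggleDown_apply, toggleUp_succ]; omega

theorem toggleUp_toggleDown (h1 : IsHorizontalStrip lam ν) (h2 : IsHorizontalStrip ρ ν) :
    toggleUp lam ρ (toggleDown lam ρ ν) (ν 0 - max (lam 0) (ρ 0)) = ν := by
  ext i
  cases i with
  | zero =>
    have a1 := h1 0
    have a2 := h2 0
    rw [toggleUp_zero]; omega
  | succ i =>
    have a1 := h1 i
    have a2 := h2 i
    have b1 := h1 (i + 1)
    have b2 := h2 (i + 1)
    rw [toggleUp_succ, toggleDown_apply]; omega

theorem degree_toggleUp (h1 : IsHorizontalStrip μ lam) (h2 : IsHorizontalStrip μ ρ) (k : ℕ) :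
    (toggleUp lam ρ μ k).degree + μ.degree = lam.degree + ρ.degree + k := by
  obtain ⟨A, hA⟩ := exists_forall_ge_eq_zero lam
  obtain ⟨B, hB⟩ := exists_forall_ge_eq_zero ρ
  obtain ⟨C, hC⟩ := exists_forall_ge_eq_zero μ
  obtain ⟨D, hD⟩ := exists_forall_ge_eq_zero (toggleUp lam ρ μ k)
  set M := A + B + C + D with hM
  rw [degree_eq_sum_range (toggleUp lam ρ μ k) (M := M + 1) fun i hi => hD i (by omega),
    degree_eq_sum_range μ (M := M) fun i hi => hC i (by omega),
    degree_eq_sum_range lam (M := M) fun i hi => hA i (by omega),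
    degree_eq_sum_range ρ (M := M) fun i hi => hB i (by omega)]
  have key : ∀ m, ∑ i ∈ range (m + 1), toggleUp lam ρ μ k i + ∑ i ∈ range m, μ i =
      ∑ i ∈ range m, lam i + ∑ i ∈ range m, ρ i + k + max (lam m) (ρ m) := by
    intro m
    induction m with
    | zero => simp [toggleUp_zero, add_comm]
    | succ m ih =>
      have a1 := h1 m
      have a2 := h2 m
      rw [Finset.sum_range_succ _ (m + 1), Finset.sum_range_succ μ, Finset.sum_range_succ lam,
        Finset.sum_range_succ ρ, toggleUp_succ]
      omega
  rw [key, hA M (by omega), hB M (by omega)]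
  simp

theorem IsHorizontalStrip.degree_le (h : IsHorizontalStrip μ ν) : μ.degree ≤ ν.degree :=
  Finsupp.degree_mono fun i => (h i).1

end Toggle

/-- The one-variable skew Cauchy identity, with the strips counted by size. -/
theorem sum_stripsBelow_stripsAbove {A : Type*} [AddCommMonoid A] (lam : ℕ →₀ ℕ) (n : ℕ)
    (F : (ℕ →₀ ℕ) → ℕ → A) :
    ∑ μ ∈ stripsBelow lam, ∑ k ∈ range (n + 1), ∑ ρ ∈ stripsAbove μ (n - k),
        F ρ (lam.degree - μ.degree + k) =
      ∑ ν ∈ stripsAbove lam n, ∑ ρ ∈ stripsBelow ν, F ρ (ν.degree - ρ.degree) := by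
  simp_rw [Finset.sum_sigma']
  refine Finset.sum_bij' (fun x _ => ⟨toggleUp lam x.2.2 x.1 x.2.1, x.2.2⟩)
    (fun y _ => ⟨toggleDown lam y.2 y.1, y.1 0 - max (lam 0) (y.2 0), y.2⟩) ?_ ?_ ?_ ?_ ?_
  · rintro ⟨μ, k, ρ⟩ h
    simp only [Finset.mem_sigma, mem_stripsBelow, mem_stripsAbove, Finset.mem_range] at h ⊢
    obtain ⟨h1, hk, h2, hd⟩ := h
    have := degree_toggleUp h1 h2 k
    refine ⟨⟨isHorizontalStrip_toggleUp h1 h2 k, by omega⟩, ?_⟩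
    rw [toggleUp_comm]
    exact isHorizontalStrip_toggleUp h2 h1 k
  · rintro ⟨ν, ρ⟩ h
    simp only [Finset.mem_sigma, mem_stripsBelow, mem_stripsAbove, Finset.mem_range] at h ⊢
    obtain ⟨⟨h1, hd⟩, h2⟩ := h
    have g1 := isHorizontalStrip_toggleDown h1 h2
    have g2 : IsHorizontalStrip (toggleDown lam ρ ν) ρ := by
      rw [toggleDown_comm]
      exact isHorizontalStrip_toggleDown h2 h1
    have := degree_toggleUp g1 g2 (ν 0 - max (lam 0) (ρ 0))
    rw [toggleUp_toggleDown h1 h2] at this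
    have := g1.degree_le
    have := g2.degree_le
    exact ⟨g1, by omega, g2, by omega⟩
  · rintro ⟨μ, k, ρ⟩ h
    simp only [Finset.mem_sigma, mem_stripsBelow, mem_stripsAbove, Finset.mem_range] at h ⊢
    obtain ⟨h1, hk, h2, hd⟩ := h
    simp [toggleDown_toggleUp h1 h2, toggleUp_zero]
  · rintro ⟨ν, ρ⟩ h
    simp only [Finset.mem_sigma, mem_stripsBelow, mem_stripsAbove] at h ⊢
    simp [toggleUp_toggleDown h.1.1 h.2]
  · rintro ⟨μ, k, ρ⟩ h
    simp only [Finset.mem_sigma, mem_stripsBelow, mem_stripsAbove, Finset.mem_range] at h ⊢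
    obtain ⟨h1, hk, h2, hd⟩ := h
    have := degree_toggleUp h1 h2 k
    have := h1.degree_le
    congr 1
    omega

/-! ### Complete homogeneous polynomials -/

theorem hsymm_option_succ {σ R : Type*} [CommSemiring R] [Fintype σ] [DecidableEq σ] (n : ℕ) :
    hsymm (Option σ) R (n + 1) =
      hsymm (Option σ) R n * X none + rename some (hsymm σ R (n + 1)) := by
  simp only [hsymm]
  rw [← Equiv.sum_comp (symOptionSuccEquiv (α := σ) (n := n)).symm, Fintype.sum_sum_type]
  congr 1
  · rw [Finset.sum_mul]
    refine Finset.sum_congr rfl fun s _ => ?_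
    simp [symOptionSuccEquiv, Sym.coe_cons, mul_comm]
  · rw [map_sum]
    refine Finset.sum_congr rfl fun s _ => ?_
    simp [symOptionSuccEquiv, map_multiset_prod]

theorem hsymm_fin_succ_succ {R : Type*} [CommSemiring R] (N n : ℕ) :
    hsymm (Fin (N + 1)) R (n + 1) = hsymm (Fin (N + 1)) R n * X (Fin.last N) +
      rename Fin.castSucc (hsymm (Fin N) R (n + 1)) := by
  have := congrArg (rename (R := R) (finSuccEquivLast (n := N)).symm)
    (hsymm_option_succ (σ := Fin N) (R := R) n)
  rw [map_add, map_mul, rename_hsymm, rename_hsymm, rename_X, rename_rename,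
    finSuccEquivLast_symm_none] at this
  rw [this]
  congr 3
  ext i
  simp

theorem hsymm_fin_succ {R : Type*} [CommSemiring R] (N n : ℕ) :
    hsymm (Fin (N + 1)) R n = ∑ k ∈ range (n + 1),
      rename Fin.castSucc (hsymm (Fin N) R (n - k)) * X (Fin.last N) ^ k := by
  induction n with
  | zero => simp
  | succ n ih =>
    rw [hsymm_fin_succ_succ, ih, Finset.sum_range_succ' _ (n + 1), Finset.sum_mul]
    simp [pow_succ, mul_assoc]

theorem hsymm_fin_zero {R : Type*} [CommSemiring R] (n : ℕ) :
    hsymm (Fin 0) R n = if n = 0 then 1 else 0 := by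
  cases n with
  | zero => simp
  | succ n =>
    simp [hsymm]

/-! ### Tableaux and the branching rule -/

/-- The semistandard tableaux of shape `ν` with entries smaller than `N`. -/
def tableaux (N : ℕ) (ν : ℕ → ℕ) : Set (ℕ → ℕ → ℕ) :=
  {T | IsSSYT ν T ∧ ∀ i j, j < ν i → T i j < N}

/-- The monomial of a tableau. -/
noncomputable def tableauMonomial (R : Type) [CommRing R] (N : ℕ) (ν : ℕ → ℕ) (T : ℕ → ℕ → ℕ) :
    MvPolynomial (Fin N) R :=
  ∏ k : Fin N, X k ^ contentCount ν T k

theorem schurPoly_eq_sum (R : Type) [CommRing R] {N : ℕ} {ν : ℕ → ℕ}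
    (hf : (tableaux N ν).Finite) :
    schurPoly R N ν = ∑ T ∈ hf.toFinset, tableauMonomial R N ν T := by
  rw [schurPoly, finsum_eq_sum_of_support_subset (s := hf.toFinset)]
  · refine Finset.sum_congr rfl fun T hT => ?_
    have h : IsSSYT ν T ∧ ∀ i j, j < ν i → T i j < N := hf.mem_toFinset.1 hT
    rw [if_pos h]
    rfl
  · intro T hT
    rw [Function.mem_support] at hT
    by_contra h
    exact hT (if_neg fun hmem => h (hf.mem_toFinset.2 hmem))

/-- Extend a filling of shape `μ` to shape `ν` by entries `N`. -/
def fillStrip (N : ℕ) (ν μ : ℕ → ℕ) (T : ℕ → ℕ → ℕ) (i j : ℕ) : ℕ :=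
  if j < μ i then T i j else if j < ν i then N else 0

section Branching

variable {N : ℕ} {μ ν : ℕ → ℕ} {T : ℕ → ℕ → ℕ}

theorem fillStrip_mem (h : IsHorizontalStrip μ ν) (hT : T ∈ tableaux N μ) :
    fillStrip N ν μ T ∈ tableaux (N + 1) ν := by
  obtain ⟨⟨hrow, hcol, hzero⟩, hlt⟩ := hT
  refine ⟨⟨fun i j1 j2 hj h2 => ?_, fun i1 i2 j hi h1 h2 => ?_, fun i j hj => ?_⟩,
    fun i j hj => ?_⟩
  · simp only [fillStrip]
    by_cases c2 : j2 < μ i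
    · rw [if_pos c2, if_pos (by omega)]
      exact hrow i j1 j2 hj c2
    · rw [if_neg c2, if_pos h2]
      split_ifs with c1
      · exact (hlt i j1 c1).le
      · exact le_rfl
      · exact Nat.zero_le _
  · have c1 : j < μ i1 := h2.trans_le ((h.antitone_right hi).trans (h i1).2)
    simp only [fillStrip]
    rw [if_pos c1]
    split_ifs with c2
    · exact hcol i1 i2 j hi c1 c2
    · exact hlt i1 j c1
  · have := (h i).1
    simp only [fillStrip]
    rw [if_neg (by omega), if_neg (by omega)]
  · simp only [fillStrip]
    split_ifs with c1
    · exact (hlt i j c1).trans (Nat.lt_succ_self N)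
    · exact Nat.lt_succ_self N

theorem lt_iff_fillStrip_lt (h : IsHorizontalStrip μ ν) (hT : T ∈ tableaux N μ) (i j : ℕ) :
    j < μ i ↔ j < ν i ∧ fillStrip N ν μ T i j < N := by
  have := (h i).1
  simp only [fillStrip]
  constructor
  · intro hj
    rw [if_pos hj]
    exact ⟨by omega, hT.2 i j hj⟩
  · rintro ⟨h1, h2⟩
    by_contra hj
    rw [if_neg hj, if_pos h1] at h2
    exact lt_irrefl _ h2

theorem eq_of_fillStrip_eq {μ' : ℕ → ℕ} {T' : ℕ → ℕ → ℕ} (h : IsHorizontalStrip μ ν)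
    (h' : IsHorizontalStrip μ' ν) (hT : T ∈ tableaux N μ) (hT' : T' ∈ tableaux N μ')
    (he : fillStrip N ν μ T = fillStrip N ν μ' T') : μ = μ' ∧ T = T' := by
  have hμ : μ = μ' := by
    ext i
    refine eq_of_forall_lt_iff fun j => ?_
    rw [lt_iff_fillStrip_lt h hT, lt_iff_fillStrip_lt h' hT', he]
  subst hμ
  refine ⟨rfl, ?_⟩
  ext i j
  by_cases hj : j < μ i
  · have := congrFun (congrFun he i) j
    simpa only [fillStrip, if_pos hj] using this
  · rw [hT.1.2.2 i j (not_lt.1 hj), hT'.1.2.2 i j (not_lt.1 hj)]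

theorem exists_fillStrip_eq (hν : Antitone ν) (hT : T ∈ tableaux (N + 1) ν) :
    ∃ μ, IsHorizontalStrip μ ν ∧ ∃ T' ∈ tableaux N μ, fillStrip N ν μ T' = T := by
  obtain ⟨⟨hrow, hcol, hzero⟩, hlt⟩ := hT
  have hex : ∀ i, ∃ j, ν i ≤ j ∨ N ≤ T i j := fun i => ⟨ν i, .inl le_rfl⟩
  set μ : ℕ → ℕ := fun i => Nat.find (hex i) with hμdef
  have hμ : ∀ i j, j < μ i ↔ j < ν i ∧ T i j < N := by
    intro i j
    rw [hμdef, Nat.lt_find_iff]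
    constructor
    · intro h
      have := h j le_rfl
      omega
    · rintro ⟨h1, h2⟩ m hm
      have := hrow i m j hm h1
      omega
  have hstrip : IsHorizontalStrip μ ν := by
    intro i
    constructor
    · by_contra hc
      exact lt_irrefl _ ((hμ i (ν i)).1 (not_le.1 hc)).1
    · by_contra hc
      have h1 : μ i < ν i := (not_le.1 hc).trans_le (hν (Nat.le_succ i))
      have h2 := hcol i (i + 1) (μ i) (Nat.lt_succ_self i) h1 (not_le.1 hc)
      have h3 := hlt (i + 1) (μ i) (not_le.1 hc)
      exact lt_irrefl _ ((hμ i (μ i)).2 ⟨h1, by omega⟩)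
  refine ⟨μ, hstrip, fun i j => if j < μ i then T i j else 0, ⟨⟨?_, ?_, ?_⟩, ?_⟩, ?_⟩
  · intro i j1 j2 hj h2
    dsimp only
    rw [if_pos h2, if_pos (hj.trans_lt h2)]
    exact hrow i j1 j2 hj ((hμ i j2).1 h2).1
  · intro i1 i2 j hi h1 h2
    dsimp only
    rw [if_pos h2, if_pos h1]
    exact hcol i1 i2 j hi ((hμ i1 j).1 h1).1 ((hμ i2 j).1 h2).1
  · intro i j hj
    exact if_neg (not_lt.2 hj)
  · intro i j hj
    dsimp only
    rw [if_pos hj]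
    exact ((hμ i j).1 hj).2
  · ext i j
    simp only [fillStrip]
    split_ifs with c1 c2
    · rfl
    · have := hlt i j c2
      have := hμ i j
      omega
    · exact (hzero i j (not_lt.1 c2)).symm

theorem contentCount_fillStrip_of_lt (h : IsHorizontalStrip μ ν) {k : ℕ} (hk : k < N) :
    contentCount ν (fillStrip N ν μ T) k = contentCount μ T k := by
  unfold contentCount
  congr 1
  ext ⟨i, j⟩
  have := (h i).1
  simp only [Set.mem_ofPred_eq, fillStrip]
  split_ifs <;> omega

end Branching

/-- The cells of the diagram of `ν`. -/
def cells (ν : ℕ →₀ ℕ) : Finset (ℕ × ℕ) :=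
  ν.support.biUnion fun i => (range (ν i)).map ⟨Prod.mk i, Prod.mk_right_injective i⟩

theorem mem_cells {ν : ℕ →₀ ℕ} {p : ℕ × ℕ} : p ∈ cells ν ↔ p.2 < ν p.1 := by
  obtain ⟨i, j⟩ := p
  simp only [cells, Finset.mem_biUnion, Finset.mem_map, Finset.mem_range, Finsupp.mem_support_iff,
    Function.Embedding.coeFn_mk, Prod.mk.injEq]
  constructor
  · rintro ⟨i, -, j, h, rfl, rfl⟩
    exact h
  · intro h
    exact ⟨i, by omega, j, h, rfl, rfl⟩

theorem card_cells (ν : ℕ →₀ ℕ) : (cells ν).card = ν.degree := by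
  rw [cells, Finset.card_biUnion]
  · simp [Finsupp.degree_apply]
  · intro i _ i' _ hne
    rw [Function.onFun, Finset.disjoint_left]
    simp only [Finset.mem_map, Function.Embedding.coeFn_mk, not_exists, not_and]
    rintro _ ⟨j, _, rfl⟩ j' _ h
    exact hne (Prod.ext_iff.1 h).1.symm

theorem contentCount_fillStrip_self {N : ℕ} {μ ν : ℕ →₀ ℕ} {T : ℕ → ℕ → ℕ}
    (h : IsHorizontalStrip μ ν) (hT : T ∈ tableaux N μ) :
    contentCount ν (fillStrip N ν μ T) N = ν.degree - μ.degree := by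
  have hsub : cells μ ⊆ cells ν := fun p hp => by
    rw [mem_cells] at hp ⊢
    exact hp.trans_le (h p.1).1
  rw [← card_cells, ← card_cells, ← Finset.card_sdiff_of_subset hsub, ← Set.ncard_coe_finset,
    contentCount]
  congr 1
  ext ⟨i, j⟩
  simp only [Set.mem_ofPred_eq, Finset.coe_sdiff, Set.mem_sdiff, Finset.mem_coe, mem_cells,
    fillStrip]
  have := hT.2 i j
  split_ifs <;> omega

theorem tableauMonomial_fillStrip (R : Type) [CommRing R] {N : ℕ} {μ ν : ℕ →₀ ℕ}
    {T : ℕ → ℕ → ℕ} (h : IsHorizontalStrip μ ν) (hT : T ∈ tableaux N μ) :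
    tableauMonomial R (N + 1) ν (fillStrip N ν μ T) =
      rename Fin.castSucc (tableauMonomial R N μ T) * X (Fin.last N) ^ (ν.degree - μ.degree) := by
  simp only [tableauMonomial, Fin.prod_univ_castSucc, Fin.val_castSucc, Fin.val_last,
    contentCount_fillStrip_self h hT, map_prod, map_pow, rename_X]
  congr 1
  exact Finset.prod_congr rfl fun k _ => by rw [contentCount_fillStrip_of_lt h k.2]

theorem exists_finsupp_of_isHorizontalStrip {μ : ℕ → ℕ} {ν : ℕ →₀ ℕ}
    (h : IsHorizontalStrip μ ν) : ∃ μ' : ℕ →₀ ℕ, ⇑μ' = μ := by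
  obtain ⟨M, hM⟩ := exists_forall_ge_eq_zero ν
  exact ⟨ofEventuallyZero μ ⟨M, fun i hi => Nat.le_zero.1 (hM i hi ▸ (h i).1)⟩, rfl⟩

theorem tableaux_zero_subset (ν : ℕ → ℕ) : tableaux 0 ν ⊆ {0} := by
  rintro T ⟨⟨-, -, hzero⟩, hlt⟩
  ext i j
  exact hzero i j (not_lt.1 fun hj => Nat.not_lt_zero _ (hlt i j hj))

theorem finite_tableaux (N : ℕ) (ν : ℕ →₀ ℕ) (hν : Antitone ν) : (tableaux N ν).Finite := by
  induction N generalizing ν with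
  | zero => exact (Set.finite_singleton _).subset (tableaux_zero_subset ν)
  | succ N ih =>
    refine Set.Finite.subset (Set.Finite.biUnion (stripsBelow ν).finite_toSet fun μ hμ =>
      (ih μ (mem_stripsBelow.1 hμ).antitone_left).image (fillStrip N ν μ)) fun T hT => ?_
    obtain ⟨μ, h, T', hT', rfl⟩ := exists_fillStrip_eq hν hT
    obtain ⟨μ, rfl⟩ := exists_finsupp_of_isHorizontalStrip h
    have hmem := Set.mem_image_of_mem (fillStrip N ν μ) hT'
    exact Set.mem_biUnion (mem_stripsBelow.2 h) hmem

/-- The branching rule for Schur polynomials. -/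
theorem schurPoly_succ (R : Type) [CommRing R] (N : ℕ) (ν : ℕ →₀ ℕ) (hν : Antitone ν) :
    schurPoly R (N + 1) ν = ∑ μ ∈ stripsBelow ν,
      rename Fin.castSucc (schurPoly R N μ) * X (Fin.last N) ^ (ν.degree - μ.degree) := by
  have hfin (μ) (hμ : μ ∈ stripsBelow ν) : (tableaux N μ).Finite :=
    finite_tableaux N μ (mem_stripsBelow.1 hμ).antitone_left
  rw [schurPoly_eq_sum R (finite_tableaux (N + 1) ν hν), ← Finset.sum_attach (stripsBelow ν)]
  have hterm (μ : {μ // μ ∈ stripsBelow ν}) :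
      rename Fin.castSucc (schurPoly R N μ.1) * X (Fin.last N) ^ (ν.degree - μ.1.degree) =
        ∑ T ∈ (hfin μ.1 μ.2).toFinset, tableauMonomial R (N + 1) ν (fillStrip N ν μ.1 T) := by
    rw [schurPoly_eq_sum R (hfin μ.1 μ.2), map_sum, Finset.sum_mul]
    refine Finset.sum_congr rfl fun T hT => ?_
    rw [tableauMonomial_fillStrip R (mem_stripsBelow.1 μ.2) ((Set.Finite.mem_toFinset _).1 hT)]
  rw [Finset.sum_congr rfl fun μ _ => hterm μ, Finset.sum_sigma']
  symm
  refine Finset.sum_bij (fun x _ => fillStrip N ν x.1.1 x.2) ?_ ?_ ?_ fun _ _ => rfl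
  · rintro ⟨⟨μ, hμ⟩, T⟩ h
    simp only [Finset.mem_sigma, Set.Finite.mem_toFinset] at h ⊢
    exact fillStrip_mem (mem_stripsBelow.1 hμ) h.2
  · rintro ⟨⟨μ, hμ⟩, T⟩ h ⟨⟨μ', hμ'⟩, T'⟩ h' he
    simp only [Finset.mem_sigma, Set.Finite.mem_toFinset] at h h'
    obtain ⟨e, rfl⟩ := eq_of_fillStrip_eq (mem_stripsBelow.1 hμ) (mem_stripsBelow.1 hμ')
      h.2 h'.2 he
    obtain rfl := DFunLike.coe_injective e
    rfl
  · intro T hT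
    obtain ⟨μ, h, T', hT', rfl⟩ := exists_fillStrip_eq hν ((Set.Finite.mem_toFinset _).1 hT)
    obtain ⟨μ, rfl⟩ := exists_finsupp_of_isHorizontalStrip h
    exact ⟨⟨⟨μ, mem_stripsBelow.2 h⟩, T'⟩, by simpa using hT', rfl⟩

theorem schurPoly_zero (R : Type) [CommRing R] (ν : ℕ →₀ ℕ) :
    schurPoly R 0 ν = if ν = 0 then 1 else 0 := by
  have hfin := (Set.finite_singleton _).subset (tableaux_zero_subset ν)
  rw [schurPoly_eq_sum R hfin]
  have hmono (T) : tableauMonomial R 0 ν T = 1 := by simp [tableauMonomial]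
  split_ifs with h
  · have : hfin.toFinset = {0} := by
      ext T
      rw [Set.Finite.mem_toFinset, Finset.mem_singleton]
      refine ⟨fun hT => tableaux_zero_subset ν hT, ?_⟩
      rintro rfl
      subst h
      simp [tableaux, IsSSYT]
    rw [this, Finset.sum_singleton, hmono]
  · refine Finset.sum_eq_zero fun T hT => absurd ?_ h
    ext i
    by_contra hi
    exact Nat.not_lt_zero _ (((Set.Finite.mem_toFinset _).1 hT).2 i 0 (Nat.pos_of_ne_zero hi))

/-- The Pieri rule, for partitions encoded as finitely supported functions. -/
theorem schurPoly_mul_hsymm (R : Type) [CommRing R] (N n : ℕ) (lam : ℕ →₀ ℕ)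
    (hanti : Antitone lam) :
    schurPoly R N lam * hsymm (Fin N) R n = ∑ ν ∈ stripsAbove lam n, schurPoly R N ν := by
  induction N generalizing n lam with
  | zero =>
    rw [schurPoly_zero, hsymm_fin_zero]
    simp_rw [schurPoly_zero]
    rw [Finset.sum_ite_eq' (stripsAbove lam n) 0 fun _ => (1 : MvPolynomial (Fin 0) R),
      ite_zero_mul_ite_zero, one_mul]
    refine if_congr ?_ rfl rfl
    rw [mem_stripsAbove]
    constructor
    · rintro ⟨rfl, rfl⟩
      exact ⟨fun i => by simp, by simp⟩
    · rintro ⟨-, h⟩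
      rw [map_zero] at h
      exact ⟨(Finsupp.degree_eq_zero_iff lam).1 (by omega), by omega⟩
  | succ N ih =>
    rw [schurPoly_succ R N lam hanti, hsymm_fin_succ, Finset.sum_mul_sum]
    have hterm (μ) (hμ : μ ∈ stripsBelow lam) (k : ℕ) :
        rename Fin.castSucc (schurPoly R N μ) * X (Fin.last N) ^ (lam.degree - μ.degree) *
            (rename Fin.castSucc (hsymm (Fin N) R (n - k)) * X (Fin.last N) ^ k) =
          ∑ ρ ∈ stripsAbove μ (n - k), rename Fin.castSucc (schurPoly R N ρ) *
            X (Fin.last N) ^ (lam.degree - μ.degree + k) := by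
      rw [← Finset.sum_mul, ← map_sum, ← ih _ _ (mem_stripsBelow.1 hμ).antitone_left, map_mul]
      ring
    rw [Finset.sum_congr rfl fun μ hμ => Finset.sum_congr rfl fun k _ => hterm μ hμ k,
      sum_stripsBelow_stripsAbove lam n
        fun ρ e => rename Fin.castSucc (schurPoly R N ρ) * X (Fin.last N) ^ e]
    exact Finset.sum_congr rfl fun ν hν =>
      (schurPoly_succ R N ν (mem_stripsAbove.1 hν).1.antitone_right).symm

/-! ### Horizontal strips in terms of columns -/

theorem finite_column {ν : ℕ → ℕ} (h : ∃ M, ∀ i, M ≤ i → ν i = 0) (j : ℕ) :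
    {i | j < ν i}.Finite := by
  obtain ⟨M, hM⟩ := h
  refine (Set.finite_Iio M).subset fun i hi => ?_
  by_contra hc
  have := hM i (not_lt.1 hc)
  simp only [Set.mem_ofPred_eq] at hi
  omega

theorem isHorizontalStrip_iff_conjPart_le {lam ν : ℕ → ℕ} (hlam : Antitone lam)
    (hfin : ∃ M, ∀ i, M ≤ i → lam i = 0) (hν : Antitone ν) (hνfin : ∃ M, ∀ i, M ≤ i → ν i = 0)
    (hle : ∀ i, lam i ≤ ν i) :
    IsHorizontalStrip lam ν ↔ ∀ j, conjPart ν j ≤ conjPart lam j + 1 := by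
  constructor
  · intro h j
    have hsub : {i | j < ν i} ⊆ insert 0 (Nat.succ '' {i | j < lam i}) := by
      rintro (_ | i) hi
      · exact Set.mem_insert _ _
      · exact Set.mem_insert_of_mem _ ⟨i, lt_of_lt_of_le hi (h i).2, rfl⟩
    refine (Set.ncard_le_ncard hsub (((finite_column hfin j).image _).insert 0)).trans
      ((Set.ncard_insert_le _ _).trans ?_)
    rw [Set.ncard_image_of_injective _ Nat.succ_injective]
    rfl
  · intro h i
    refine ⟨hle i, ?_⟩
    by_contra hc
    have h1 : Set.Iic (i + 1) ⊆ {i' | lam i < ν i'} := fun i' hi' =>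
      (not_le.1 hc).trans_le (hν hi')
    have h2 : {i' | lam i < lam i'} ⊆ Set.Iio i := fun i' hi' => by
      by_contra hi
      exact absurd (hlam (not_lt.1 hi)) (not_le.2 hi')
    have c1 := Set.ncard_le_ncard h1 (finite_column hνfin _)
    have c2 := Set.ncard_le_ncard h2 (Set.finite_Iio i)
    rw [← Finset.coe_Iic, Set.ncard_coe_finset, Nat.card_Iic] at c1
    rw [← Finset.coe_Iio, Set.ncard_coe_finset, Nat.card_Iio] at c2
    have := h (lam i)
    simp only [conjPart] at this
    omega

theorem stmt4 (N n : ℕ) (hN : 1 ≤ N) (lam : ℕ → ℕ) (hanti : Antitone lam)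
    (hfin : ∃ M, ∀ i, M ≤ i → lam i = 0) :
    schurPoly ℤ N lam * MvPolynomial.hsymm (Fin N) ℤ n
      = ∑ᶠ ν : ℕ → ℕ,
          if Antitone ν ∧ (∃ M, ∀ i, M ≤ i → ν i = 0) ∧ (∀ i, lam i ≤ ν i) ∧
              (∑ᶠ i, ν i) = (∑ᶠ i, lam i) + n ∧ (∀ j, conjPart ν j ≤ conjPart lam j + 1)
          then schurPoly ℤ N ν else 0 := by
  obtain ⟨lam, rfl⟩ : ∃ l : ℕ →₀ ℕ, ⇑l = lam := ⟨ofEventuallyZero lam hfin, rfl⟩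
  have hiff (ν : ℕ →₀ ℕ) : (Antitone ν ∧ (∃ M, ∀ i, M ≤ i → ν i = 0) ∧ (∀ i, lam i ≤ ν i) ∧
      (∑ᶠ i, ν i) = (∑ᶠ i, lam i) + n ∧ ∀ j, conjPart ν j ≤ conjPart lam j + 1) ↔
      ν ∈ stripsAbove lam n := by
    rw [mem_stripsAbove, finsum_eq_degree, finsum_eq_degree]
    constructor
    · rintro ⟨h1, h2, h3, h4, h5⟩
      exact ⟨(isHorizontalStrip_iff_conjPart_le hanti hfin h1 h2 h3).2 h5, h4⟩
    · rintro ⟨h, h4⟩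
      have h3 : ∀ i, lam i ≤ ν i := fun i => (h i).1
      have h2 := exists_forall_ge_eq_zero ν
      exact ⟨h.antitone_right, h2, h3, h4,
        (isHorizontalStrip_iff_conjPart_le hanti hfin h.antitone_right h2 h3).1 h⟩
  rw [schurPoly_mul_hsymm ℤ N n lam hanti, finsum_eq_sum_of_support_subset
    (s := (stripsAbove lam n).map ⟨fun ν : ℕ →₀ ℕ => ⇑ν, DFunLike.coe_injective⟩), Finset.sum_map]
  · exact Finset.sum_congr rfl fun ν hν => (if_pos ((hiff ν).2 hν)).symm
  · intro ν hν
    rw [Function.mem_support] at hν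
    have hcond := (ite_ne_right_iff.1 hν).1
    obtain ⟨ν, rfl⟩ : ∃ l : ℕ →₀ ℕ, ⇑l = ν := ⟨ofEventuallyZero ν hcond.2.1, rfl⟩
    simpa using (hiff ν).1 hcond

end PlethysmSquare
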